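/- Let N >= 2 and T >= 2, and let Z be the NT x (1 + (N-1) + (T-1)) two-way fixed effects design matrix. Then Z'Z is invertible and its inverse is the block matrix [[ (N+T-1)/(NT), -(1/T) * iota'_{N-1}, -(1/N) * iota'_{T-1} ], [ -(1/T) * iota_{N-1}, (1/T) * (I_{N-1} + 1_{(N-1) x (N-1)}), O_{(N-1) x (T-1)} ], [ -(1/N) * iota_{T-1}, O_{(T-1) x (N-1)}, (1/N) * (I_{T-1} + 1_{(T-1) x (T-1)}) ]], where O_{K x Q} is the K x Q zero matrix. -/

import Mathlib

open Matrix

/-- The two-way fixed effects design matrix: rows indexed by pairs `(i, t)` of a unit and a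
time period; columns consist of an intercept column of ones, unit dummies for units `i ≠ 0`,
and time dummies for periods `t ≠ 0`. -/
def designZ (N T : ℕ) :
    Matrix (Fin N × Fin T) (Unit ⊕ ({j : Fin N // (j : ℕ) ≠ 0} ⊕ {s : Fin T // (s : ℕ) ≠ 0})) ℝ :=
  fun p c =>
    match c with
    | Sum.inl _ => 1
    | Sum.inr (Sum.inl j) => if p.1 = j.1 then 1 else 0
    | Sum.inr (Sum.inr s) => if p.2 = s.1 then 1 else 0

theorem card_ne_zero_fin (N : ℕ) (hN : 1 ≤ N) :
    ((Fintype.card {j : Fin N // (j : ℕ) ≠ 0} : ℕ) : ℝ) = (N : ℝ) - 1 := by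
  obtain ⟨n, rfl⟩ : ∃ n, N = n + 1 := ⟨N - 1, by omega⟩
  have h : Fintype.card {j : Fin (n + 1) // (j : ℕ) ≠ 0} = n := by
    have h1 : Fintype.card {j : Fin (n + 1) // (j : ℕ) ≠ 0}
        = Fintype.card {j : Fin (n + 1) // j ≠ 0} :=
      Fintype.card_congr (Equiv.subtypeEquivRight (fun j => not_congr Fin.val_eq_zero_iff))
    rw [h1]
    simp
  rw [h]
  push_cast
  ring

theorem gram_eq (N T : ℕ) : (designZ N T)ᵀ * designZ N T =
    Matrix.of (Sum.elim
      (fun _ => Sum.elim (fun _ => (N : ℝ) * T) (Sum.elim (fun _ => (T : ℝ)) (fun _ => (N : ℝ))))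
      (Sum.elim
        (fun j => Sum.elim (fun _ => (T : ℝ))
          (Sum.elim (fun j' => if j = j' then (T : ℝ) else 0) (fun _ => 1)))
        (fun s => Sum.elim (fun _ => (N : ℝ))
          (Sum.elim (fun _ => 1) (fun s' => if s = s' then (N : ℝ) else 0))))) := by
  ext c d
  rcases c with c | c | c <;> rcases d with d | d | d <;>
    simp [designZ, Matrix.mul_apply, Fintype.sum_prod_type, Subtype.ext_iff, eq_comm, -Finset.sum_boole]

/-- for `N ≥ 2` and `T ≥ 2`, `Z'Z` is invertible, with inverse the block matrix
`[[ (N+T-1)/(NT), -(1/T) ι'_{N-1}, -(1/N) ι'_{T-1} ],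
  [ -(1/T) ι_{N-1}, (1/T)(I_{N-1} + 1_{(N-1)×(N-1)}), O ],
  [ -(1/N) ι_{T-1}, O, (1/N)(I_{T-1} + 1_{(T-1)×(T-1)}) ]]`. -/
theorem designZ_gram_inverse (N T : ℕ) (hN : 2 ≤ N) (hT : 2 ≤ T) :
    IsUnit ((designZ N T)ᵀ * designZ N T) ∧
    ((designZ N T)ᵀ * designZ N T)⁻¹ =
      Matrix.of (fun c d :
          Unit ⊕ ({j : Fin N // (j : ℕ) ≠ 0} ⊕ {s : Fin T // (s : ℕ) ≠ 0}) =>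
        match c, d with
        | Sum.inl _, Sum.inl _ => ((N : ℝ) + T - 1) / ((N : ℝ) * T)
        | Sum.inl _, Sum.inr (Sum.inl _) => -(1 / (T : ℝ))
        | Sum.inl _, Sum.inr (Sum.inr _) => -(1 / (N : ℝ))
        | Sum.inr (Sum.inl _), Sum.inl _ => -(1 / (T : ℝ))
        | Sum.inr (Sum.inl j), Sum.inr (Sum.inl j') =>
            (1 / (T : ℝ)) * ((if j = j' then 1 else 0) + 1)
        | Sum.inr (Sum.inl _), Sum.inr (Sum.inr _) => 0
        | Sum.inr (Sum.inr _), Sum.inl _ => -(1 / (N : ℝ))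
        | Sum.inr (Sum.inr _), Sum.inr (Sum.inl _) => 0
        | Sum.inr (Sum.inr s), Sum.inr (Sum.inr s') =>
            (1 / (N : ℝ)) * ((if s = s' then 1 else 0) + 1)) := by
  have hN0 : (N : ℝ) ≠ 0 := by
    have : N ≠ 0 := by omega
    exact_mod_cast this
  have hT0 : (T : ℝ) ≠ 0 := by
    have : T ≠ 0 := by omega
    exact_mod_cast this
  have key := fun B h => (⟨(Matrix.isUnit_iff_isUnit_det _).2
    (Matrix.isUnit_det_of_right_inverse (B := B) h), Matrix.inv_eq_right_inv h⟩ :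
    IsUnit ((designZ N T)ᵀ * designZ N T) ∧ ((designZ N T)ᵀ * designZ N T)⁻¹ = B)
  apply key
  have cN := card_ne_zero_fin N (by omega)
  have cT := card_ne_zero_fin T (by omega)
  rw [gram_eq]
  ext c d
  rcases c with c | c | c <;> rcases d with d | d | d <;>
    simp [Matrix.mul_apply, Matrix.one_apply, Fintype.sum_sum_type, mul_add,
      Finset.sum_add_distrib, cN, cT, -Fintype.card_subtype_compl, -ne_eq] <;>
    (try split_ifs) <;> field_simp <;> ring
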